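/- There exist C^∞ functions p, q : ℝ → ℝ (namely q(x) = x + x² and p(x) = q(x) + θ(x) with θ(x) = e^{−1/|x|}, θ(0)=0) such that p(0) = q(0) = 0, p'(0) = q'(0) = 1, p ≠ q on every punctured neighborhood of 0, yet the limit as t → 0⁺ of (q(t) − p(t)) / (q(q(t)) − p(q(t)))... equivalently of θ(t)/θ(t + t²), equals e^{−1} ≠ 1. -/

import Mathlib

open Real Filter Topology

/-- The flat function `θ(x) = e^{-1/|x|}` for `x ≠ 0`, `θ(0) = 0`. -/
noncomputable def theta (x : ℝ) : ℝ := if x = 0 then 0 else Real.exp (-1 / |x|)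

lemma theta_eq_glue : theta = fun x => expNegInvGlue x + expNegInvGlue (-x) := by
  funext x
  rcases lt_trichotomy x 0 with h | h | h
  · have h1 : ¬ (0 ≤ x) := not_le.2 h
    simp [theta, expNegInvGlue, h.ne, h.le, h1, abs_of_neg h, neg_div, div_neg, inv_neg]
  · simp [theta, h]
  · have h1 : ¬ (x ≤ 0) := not_le.2 h
    simp [theta, expNegInvGlue, h.ne', h.le, h1, abs_of_pos h, neg_div]

lemma theta_contDiff : ContDiff ℝ (⊤ : ℕ∞) theta := by
  rw [theta_eq_glue]
  exact expNegInvGlue.contDiff.add (expNegInvGlue.contDiff.comp contDiff_neg)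

lemma theta_pos {x : ℝ} (h : x ≠ 0) : 0 < theta x := by
  simp [theta, h, Real.exp_pos]

lemma theta_zero : theta 0 = 0 := by simp [theta]

lemma theta_hasDerivAt : HasDerivAt theta 0 0 := by
  have hd : DifferentiableAt ℝ theta 0 :=
    (theta_contDiff.differentiable (by simp)).differentiableAt
  have hm : IsLocalMin theta 0 := by
    refine Filter.Eventually.of_forall fun x => ?_
    rw [theta_zero]
    by_cases h : x = 0
    · simp [h, theta_zero]
    · exact (theta_pos h).le
  have := hd.hasDerivAt
  rwa [hm.deriv_eq_zero] at this

theorem arnold_counterexample :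
    ∃ p q : ℝ → ℝ, p = (fun x => x + x ^ 2 + theta x) ∧ q = (fun x => x + x ^ 2) ∧
      ContDiff ℝ (⊤ : ℕ∞) p ∧ ContDiff ℝ (⊤ : ℕ∞) q ∧
      p 0 = 0 ∧ q 0 = 0 ∧ deriv p 0 = 1 ∧ deriv q 0 = 1 ∧
      (∀ x : ℝ, x ≠ 0 → p x ≠ q x) ∧
      Tendsto (fun t : ℝ => (q t - p t) / (q (q t) - p (q t))) (𝓝[>] (0 : ℝ))
        (𝓝 (Real.exp (-1))) ∧
      Real.exp (-1) ≠ 1 := by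
  have hq : ContDiff ℝ (⊤ : ℕ∞) (fun x : ℝ => x + x ^ 2) := by fun_prop
  have hq' : HasDerivAt (fun x : ℝ => x + x ^ 2) 1 0 := by
    simpa using (hasDerivAt_id' (0 : ℝ)).fun_add (hasDerivAt_pow 2 (0 : ℝ))
  have hp' : HasDerivAt (fun x : ℝ => x + x ^ 2 + theta x) 1 0 := by
    simpa using hq'.fun_add theta_hasDerivAt
  refine ⟨_, _, rfl, rfl, hq.add theta_contDiff, hq, by simp [theta_zero], by simp,
    hp'.deriv, hq'.deriv, ?_, ?_, ?_⟩
  · intro x hx h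
    have := theta_pos hx
    linarith
  · have h1 : Tendsto (fun t : ℝ => Real.exp (-1 / (1 + t))) (𝓝[>] (0 : ℝ))
        (𝓝 (Real.exp (-1))) := by
      have hc : ContinuousAt (fun t : ℝ => Real.exp (-1 / (1 + t))) 0 := by
        have : (1 + (0 : ℝ)) ≠ 0 := by norm_num
        fun_prop (disch := assumption)
      have := hc.tendsto.mono_left (nhdsWithin_le_nhds (s := Set.Ioi (0 : ℝ)))
      simpa using this
    refine h1.congr' ?_
    filter_upwards [self_mem_nhdsWithin] with t ht
    have ht : 0 < t := ht
    have hs : 0 < t + t ^ 2 := by positivity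
    have e : ∀ a b : ℝ, a - (a + b) = -b := fun a b => by ring
    simp only [e, neg_div_neg_eq]
    simp only [theta, ht.ne', hs.ne', if_false, abs_of_pos ht, abs_of_pos hs]
    rw [← Real.exp_sub]
    congr 1
    have : 1 + t ≠ 0 := by positivity
    have h3 : t + t ^ 2 = t * (1 + t) := by ring
    rw [h3]
    field_simp
    ring
  · have : Real.exp (-1) < 1 := by
      rw [Real.exp_lt_one_iff]; norm_num
    exact this.ne
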